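/- For every unordered pair e of distinct vertices, Σ_{t ∈ T, e ⊆ t} p_t ≤ 3; equivalently, the assignment y_t = p_t/3 is a feasible solution of the fractional bad-triangle packing (Σ_{t ∋ e} y_t ≤ 1 for every pair e). -/

import Mathlib

open scoped Classical

namespace TruncatedPivot

/-- Status of a node during the run of (sequential) Truncated-Pivot. -/
inductive Status (N : ℕ) where
  | active : Status N
  | singleton : Status N
  | clustered : Fin N → Status N
  deriving DecidableEq

variable {N : ℕ}

/-- Degree of `u`: number of positive edges incident on `u`. -/
def deg (adj : Fin N → Fin N → Bool) (u : Fin N) : ℕ :=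
  (Finset.univ.filter fun v => adj u v = true).card

/-- Number of disagreements of the clustering whose parts are the fibers of `f`:
positive pairs split between two parts plus negative pairs inside one part. -/
def cost (adj : Fin N → Fin N → Bool) (f : Fin N → Fin N) : ℕ :=
  (Finset.univ.filter fun p : Fin N × Fin N =>
    p.1 < p.2 ∧ ((adj p.1 p.2 = true ∧ f p.1 ≠ f p.2) ∨
      (adj p.1 p.2 = false ∧ f p.1 = f p.2))).card

/-- Minimum number of disagreements over all clusterings (every partition of `Fin N`
arises as the fibers of some `f : Fin N → Fin N`). -/
noncomputable def OPT (adj : Fin N → Fin N → Bool) : ℕ :=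
  sInf (Set.range (cost adj))

/-- The singleton-creating sub-step of iteration `i` of sequential Truncated-Pivot:
every active node `v` with `deg v ≥ (c/ε)·(N·log N)/i` (equivalently
`deg v · i ≥ (c/ε)·(N·log N)`, as `i ≥ 1`) becomes a singleton cluster. -/
noncomputable def singStep (adj : Fin N → Fin N → Bool) (c ε : ℝ) (i : ℕ)
    (s : Fin N → Status N) : Fin N → Status N := fun v =>
  if s v = Status.active ∧ (c / ε) * ((N : ℝ) * Real.log N) ≤ (deg adj v : ℝ) * (i : ℝ) then
    Status.singleton
  else s v

/-- The pivot sub-step: if `u` is still active, it forms a pivot cluster together with all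
of its currently active positive neighbors. -/
def pivStep (adj : Fin N → Fin N → Bool) (u : Fin N) (s : Fin N → Status N) :
    Fin N → Status N := fun v =>
  if s u = Status.active ∧ s v = Status.active ∧ (v = u ∨ adj u v = true) then
    Status.clustered u
  else s v

/-- `seqStates adj c ε π k` is the status of every node after the first `k` iterations of
sequential Truncated-Pivot run with permutation `π` (iteration `i = k+1` processes the
node at position `i`, i.e. `π.symm ⟨k⟩`). -/
noncomputable def seqStates (adj : Fin N → Fin N → Bool) (c ε : ℝ) (π : Equiv.Perm (Fin N)) :
    ℕ → Fin N → Status N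
  | 0 => fun _ => Status.active
  | k + 1 =>
    if h : k < N then
      pivStep adj (π.symm ⟨k, h⟩) (singStep adj c ε (k + 1) (seqStates adj c ε π k))
    else seqStates adj c ε π k

/-- The cluster label (representative) of each node in the clustering output by
sequential Truncated-Pivot: members of the pivot cluster of pivot `p` get label `p`,
singleton clusters get the node itself. -/
noncomputable def seqLabel (adj : Fin N → Fin N → Bool) (c ε : ℝ) (π : Equiv.Perm (Fin N))
    (v : Fin N) : Fin N :=
  match seqStates adj c ε π N v with
  | Status.clustered p => p
  | _ => v

/-- The state in iteration `k+1` just after the singleton sub-step and right before the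
pivot sub-step. -/
noncomputable def midState (adj : Fin N → Fin N → Bool) (c ε : ℝ) (π : Equiv.Perm (Fin N))
    (k : ℕ) : Fin N → Status N :=
  singStep adj c ε (k + 1) (seqStates adj c ε π k)

/-- Membership in the (potential) pivot cluster of pivot `p`. -/
def inPivCluster (adj : Fin N → Fin N → Bool) (p v : Fin N) : Prop :=
  v = p ∨ adj p v = true

/-- The (positive) edge `{a,b}` is cut by the pivot cluster created at iteration `k+1`:
the pivot and both endpoints are active when the cluster is created, and exactly one of
`a`, `b` is included in the cluster. -/
def cutAt (adj : Fin N → Fin N → Bool) (c ε : ℝ) (π : Equiv.Perm (Fin N)) (k : Fin N)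
    (a b : Fin N) : Prop :=
  midState adj c ε π k.val (π.symm k) = Status.active ∧
  midState adj c ε π k.val a = Status.active ∧
  midState adj c ε π k.val b = Status.active ∧
  ((inPivCluster adj (π.symm k) a ∧ ¬ inPivCluster adj (π.symm k) b) ∨
    (inPivCluster adj (π.symm k) b ∧ ¬ inPivCluster adj (π.symm k) a))

/-- `C^pivot`: the number of disagreements induced by the pivot clusters of sequential
Truncated-Pivot: negative pairs inside a common pivot cluster, plus positive edges cut
by a pivot cluster at the iteration it was created. -/
noncomputable def Cpivot (adj : Fin N → Fin N → Bool) (c ε : ℝ) (π : Equiv.Perm (Fin N)) : ℕ :=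
  (Finset.univ.filter fun p : Fin N × Fin N =>
    p.1 < p.2 ∧
      ((adj p.1 p.2 = true ∧ ∃ k : Fin N, cutAt adj c ε π k p.1 p.2) ∨
        (adj p.1 p.2 = false ∧ ∃ q : Fin N,
          seqStates adj c ε π N p.1 = Status.clustered q ∧
          seqStates adj c ε π N p.2 = Status.clustered q))).card

/-- A bad triangle: three distinct vertices with exactly two positive edges. -/
def IsBadTriangle (adj : Fin N → Fin N → Bool) (t : Finset (Fin N)) : Prop :=
  ∃ u v w : Fin N, t = {u, v, w} ∧ u ≠ v ∧ v ≠ w ∧ u ≠ w ∧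
    adj u v = true ∧ adj v w = true ∧ adj u w = false

/-- The set `T` of all bad triangles. -/
noncomputable def badTriangles (adj : Fin N → Fin N → Bool) : Finset (Finset (Fin N)) :=
  Finset.univ.filter (IsBadTriangle adj)

/-- The event `A_t`: at some iteration of sequential Truncated-Pivot all three nodes of the
bad triangle `t` are active and one of them is the node of that iteration (hence it
creates a pivot cluster). -/
def eventA (adj : Fin N → Fin N → Bool) (c ε : ℝ) (t : Finset (Fin N))
    (π : Equiv.Perm (Fin N)) : Prop :=
  ∃ k : Fin N, π.symm k ∈ t ∧ ∀ x ∈ t, midState adj c ε π k.val x = Status.active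

/-- `N_i(u)`: positive neighbors `v` of `u` with `deg v ≤ deg u` that have not joined a
pivot cluster before iteration `i` (i.e. in the state at the beginning of iteration `i`). -/
noncomputable def NdegI (adj : Fin N → Fin N → Bool) (c ε : ℝ) (π : Equiv.Perm (Fin N))
    (i : ℕ) (u : Fin N) : Finset (Fin N) :=
  Finset.univ.filter fun v => adj u v = true ∧ deg adj v ≤ deg adj u ∧
    ∀ p : Fin N, seqStates adj c ε π (i - 1) v ≠ Status.clustered p

/-- `u` is placed into a singleton cluster at iteration `i` (`1 ≤ i ≤ N`). -/
def becomesSingletonAt (adj : Fin N → Fin N → Bool) (c ε : ℝ) (π : Equiv.Perm (Fin N))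
    (u : Fin N) (i : ℕ) : Prop :=
  1 ≤ i ∧ i ≤ N ∧ seqStates adj c ε π (i - 1) u = Status.active ∧
    seqStates adj c ε π i u = Status.singleton

/-- `E^sin`: positive edges with at least one endpoint in a singleton cluster. -/
noncomputable def Esin (adj : Fin N → Fin N → Bool) (c ε : ℝ) (π : Equiv.Perm (Fin N)) :
    Finset (Fin N × Fin N) :=
  Finset.univ.filter fun p => p.1 < p.2 ∧ adj p.1 p.2 = true ∧
    (seqStates adj c ε π N p.1 = Status.singleton ∨
      seqStates adj c ε π N p.2 = Status.singleton)

/-- A good edge of `E^sin`: one endpoint is placed into a singleton cluster at some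
iteration `i` and the other endpoint had joined a pivot cluster at some iteration `j < i`. -/
def goodPair (adj : Fin N → Fin N → Bool) (c ε : ℝ) (π : Equiv.Perm (Fin N))
    (a b : Fin N) : Prop :=
  (∃ i : ℕ, becomesSingletonAt adj c ε π a i ∧
    ∃ p : Fin N, seqStates adj c ε π (i - 1) b = Status.clustered p) ∨
  (∃ i : ℕ, becomesSingletonAt adj c ε π b i ∧
    ∃ p : Fin N, seqStates adj c ε π (i - 1) a = Status.clustered p)

/-- `E^bad`: the edges of `E^sin` that are not good. -/
noncomputable def Ebad (adj : Fin N → Fin N → Bool) (c ε : ℝ) (π : Equiv.Perm (Fin N)) :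
    Finset (Fin N × Fin N) :=
  (Esin adj c ε π).filter fun p => ¬ goodPair adj c ε π p.1 p.2

/-- A node `u` is interesting for permutation `π` iff `π_u < τ_u`, i.e.
`π_u · deg u < (c/ε)·(N·log N)` where `π_u ∈ {1,…,N}` is the position of `u`. -/
def interesting (adj : Fin N → Fin N → Bool) (c ε : ℝ) (π : Equiv.Perm (Fin N))
    (u : Fin N) : Prop :=
  (((π u).val : ℝ) + 1) * (deg adj u : ℝ) < (c / ε) * ((N : ℝ) * Real.log N)

/-- The greedy maximal independent set of `G_store` (the subgraph induced by the
interesting nodes) along `π`: nodes are processed in increasing order of position and a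
node joins iff it is interesting and has no earlier neighbor already in the set. -/
noncomputable def pivots (adj : Fin N → Fin N → Bool) (c ε : ℝ) (π : Equiv.Perm (Fin N)) :
    Finset (Fin N) :=
  (List.finRange N).foldl
    (fun I j =>
      if interesting adj c ε π (π.symm j) ∧ ∀ v ∈ I, adj (π.symm j) v = false then
        insert (π.symm j) I
      else I) ∅

/-- The cluster label of each node in the clustering output by parallel Truncated-Pivot:
pivots are their own label; a non-pivot `u` joins its pivot positive neighbor `v` of
smallest position provided `π_v < τ_u`; all remaining nodes form singleton clusters. -/
noncomputable def parLabel (adj : Fin N → Fin N → Bool) (c ε : ℝ) (π : Equiv.Perm (Fin N))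
    (u : Fin N) : Fin N :=
  if u ∈ pivots adj c ε π then u
  else
    let S := (pivots adj c ε π).filter fun v => adj u v = true ∧
      (((π v).val : ℝ) + 1) * (deg adj u : ℝ) < (c / ε) * ((N : ℝ) * Real.log N)
    if h : S.Nonempty then π.symm ((S.image fun v => π v).min' (h.image _)) else u

/-- The number of positive edges with at least one interesting endpoint (i.e. with at
least one endpoint in `G_store`). -/
noncomputable def interEdges (adj : Fin N → Fin N → Bool) (c ε : ℝ)
    (π : Equiv.Perm (Fin N)) : Finset (Fin N × Fin N) :=
  Finset.univ.filter fun p => p.1 < p.2 ∧ adj p.1 p.2 = true ∧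
    (interesting adj c ε π p.1 ∨ interesting adj c ε π p.2)

/-- Probability of an event over a uniformly random permutation of `Fin N`. -/
noncomputable def Pr (N : ℕ) (P : Equiv.Perm (Fin N) → Prop) : ℝ :=
  ((Finset.univ.filter P).card : ℝ) / (Nat.factorial N : ℝ)

/-- Expectation of a real random variable over a uniformly random permutation of `Fin N`. -/
noncomputable def Ex (N : ℕ) (X : Equiv.Perm (Fin N) → ℝ) : ℝ :=
  (∑ π : Equiv.Perm (Fin N), X π) / (Nat.factorial N : ℝ)



/-- The run up to iteration `k` depends only on the nodes processed before iteration `k + 1`. -/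
lemma seqStates_congr (adj : Fin N → Fin N → Bool) (c ε : ℝ) {π π' : Equiv.Perm (Fin N)} (k : ℕ)
    (h : ∀ j : Fin N, j.val < k → π.symm j = π'.symm j) :
    seqStates adj c ε π k = seqStates adj c ε π' k := by
  induction k with
  | zero => rfl
  | succ k ih =>
    have hk := ih fun j hj => h j (by omega)
    simp only [seqStates, hk]
    split_ifs with hN
    · rw [h ⟨k, hN⟩ (Nat.lt_succ_self k)]
    · rfl

lemma seqStates_active_of_midState {adj : Fin N → Fin N → Bool} {c ε : ℝ}
    {π : Equiv.Perm (Fin N)} {k : ℕ} {x : Fin N}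
    (h : midState adj c ε π k x = Status.active) :
    seqStates adj c ε π k x = Status.active := by
  unfold midState singStep at h
  split_ifs at h
  exact h

/-- A node active after an iteration was active right before its pivot sub-step and was not
taken by the pivot of that iteration. -/
lemma midState_active_of_seqStates_succ {adj : Fin N → Fin N → Bool} {c ε : ℝ}
    {π : Equiv.Perm (Fin N)} {j : Fin N} {x : Fin N}
    (h : seqStates adj c ε π (j.val + 1) x = Status.active) :
    midState adj c ε π j x = Status.active ∧
      ¬ (midState adj c ε π j (π.symm j) = Status.active ∧ inPivCluster adj (π.symm j) x) := by
  rw [seqStates, dif_pos j.isLt] at h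
  change pivStep adj (π.symm j) (midState adj c ε π j) x = _ at h
  unfold pivStep at h
  split_ifs at h with hc
  exact ⟨h, fun hp => hc ⟨hp.1, h, hp.2⟩⟩

lemma seqStates_active_anti {adj : Fin N → Fin N → Bool} {c ε : ℝ}
    {π : Equiv.Perm (Fin N)} {x : Fin N} {j k : ℕ} (hjk : j ≤ k)
    (h : seqStates adj c ε π k x = Status.active) :
    seqStates adj c ε π j x = Status.active := by
  induction k, hjk using Nat.le_induction with
  | base => exact h
  | succ k _ ih =>
    refine ih ?_
    by_cases hk : k < N
    · exact seqStates_active_of_midState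
        (midState_active_of_seqStates_succ (j := ⟨k, hk⟩) h).1
    · rwa [seqStates, dif_neg hk] at h

/-- A node that is still active was not taken by any earlier pivot. -/
lemma midState_active_of_lt {adj : Fin N → Fin N → Bool} {c ε : ℝ}
    {π : Equiv.Perm (Fin N)} {x : Fin N} {j k : Fin N} (hjk : j < k)
    (h : midState adj c ε π k x = Status.active) :
    midState adj c ε π j x = Status.active ∧
      ¬ (midState adj c ε π j (π.symm j) = Status.active ∧ inPivCluster adj (π.symm j) x) :=
  midState_active_of_seqStates_succ
    (seqStates_active_anti (Nat.succ_le_of_lt hjk) (seqStates_active_of_midState h))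

/-- A node that is still active has not been processed before. -/
lemma le_of_midState_active {adj : Fin N → Fin N → Bool} {c ε : ℝ}
    {π : Equiv.Perm (Fin N)} {x k : Fin N} (h : midState adj c ε π k x = Status.active) :
    k ≤ π x := by
  by_contra! hlt
  obtain ⟨h₁, h₂⟩ := midState_active_of_lt hlt h
  rw [Equiv.symm_apply_apply] at h₂
  exact h₂ ⟨h₁, Or.inl rfl⟩

/-- All nodes of `t` are active at the iteration in which `u` is processed. -/
def allActiveAt (adj : Fin N → Fin N → Bool) (c ε : ℝ) (t : Finset (Fin N)) (u : Fin N)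
    (π : Equiv.Perm (Fin N)) : Prop :=
  ∀ x ∈ t, midState adj c ε π (π u) x = Status.active

/-- Exchanging the positions of two nodes of `t` exchanges their roles as pivot. -/
lemma allActiveAt_mul_swap {adj : Fin N → Fin N → Bool} {c ε : ℝ} {t : Finset (Fin N)}
    {u w : Fin N} (hu : u ∈ t) (hw : w ∈ t) {π : Equiv.Perm (Fin N)}
    (h : allActiveAt adj c ε t u π) : allActiveAt adj c ε t w (π * Equiv.swap u w) := by
  have heq : seqStates adj c ε (π * Equiv.swap u w) (π u) = seqStates adj c ε π (π u) := by
    refine seqStates_congr adj c ε _ fun j hj => ?_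
    have hne : ∀ x ∈ t, π.symm j ≠ x := by
      rintro x hx rfl
      have := le_of_midState_active (h _ hx)
      rw [Equiv.apply_symm_apply] at this
      exact absurd hj (not_lt.mpr this)
    change Equiv.swap u w (π.symm j) = π.symm j
    exact Equiv.swap_apply_of_ne_of_ne (hne u hu) (hne w hw)
  intro x hx
  rw [Equiv.Perm.mul_apply, Equiv.swap_apply_right, midState, heq]
  exact h x hx

lemma card_allActiveAt_le (adj : Fin N → Fin N → Bool) (c ε : ℝ) {t : Finset (Fin N)}
    {u w : Fin N} (hu : u ∈ t) (hw : w ∈ t) :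
    (Finset.univ.filter (allActiveAt adj c ε t u)).card ≤
      (Finset.univ.filter (allActiveAt adj c ε t w)).card := by
  refine Finset.card_le_card_of_injOn (· * Equiv.swap u w) (fun π hπ => ?_)
    (mul_left_injective _).injOn
  simp only [Finset.coe_filter, Finset.mem_univ, true_and, Set.mem_ofPred_eq] at hπ ⊢
  exact allActiveAt_mul_swap hu hw hπ

/-- Every node of `t` is the pivot in at least a `1 / |t|` fraction of the event `A_t`. -/
lemma card_eventA_le (adj : Fin N → Fin N → Bool) (c ε : ℝ) {t : Finset (Fin N)}
    {w : Fin N} (hw : w ∈ t) :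
    (Finset.univ.filter (eventA adj c ε t)).card ≤
      t.card * (Finset.univ.filter (allActiveAt adj c ε t w)).card := by
  have hsub : Finset.univ.filter (eventA adj c ε t) ⊆
      t.biUnion fun u => Finset.univ.filter (allActiveAt adj c ε t u) := by
    intro π hπ
    obtain ⟨k, hk, h⟩ := (Finset.mem_filter.mp hπ).2
    refine Finset.mem_biUnion.mpr ⟨_, hk, Finset.mem_filter.mpr ⟨Finset.mem_univ _, ?_⟩⟩
    simpa only [allActiveAt, Equiv.apply_symm_apply] using h
  exact (Finset.card_le_card hsub).trans
    (Finset.card_biUnion_le_card_mul _ _ _ fun u hu => card_allActiveAt_le adj c ε hu hw)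

/-- The third node of a bad triangle on the pair `a`, `b` is a positive neighbor of `a` or `b`. -/
lemma IsBadTriangle.exists_third {adj : Fin N → Fin N → Bool}
    (hsymm : ∀ u v, adj u v = adj v u) {t : Finset (Fin N)} (ht : IsBadTriangle adj t)
    {a b : Fin N} (hab : a ≠ b) (ha : a ∈ t) (hb : b ∈ t) :
    ∃ w, t = {a, b, w} ∧ t.card = 3 ∧ (adj w a = true ∨ adj w b = true) := by
  obtain ⟨u, v, w, rfl, huv, hvw, huw, h₁, h₂, -⟩ := ht
  have hcard : ({u, v, w} : Finset (Fin N)).card = 3 := Finset.card_eq_three.mpr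
    ⟨u, v, w, huv, huw, hvw, rfl⟩
  have h₁' := (hsymm v u).trans h₁
  have h₂' := (hsymm w v).trans h₂
  simp only [Finset.mem_insert, Finset.mem_singleton] at ha hb
  rcases ha with rfl | rfl | rfl <;> rcases hb with rfl | rfl | rfl
  · exact absurd rfl hab
  · exact ⟨w, rfl, hcard, Or.inr h₂'⟩
  · exact ⟨v, by grind, hcard, Or.inl h₁'⟩
  · exact ⟨w, by grind, hcard, Or.inl h₂'⟩
  · exact absurd rfl hab
  · exact ⟨u, by grind, hcard, Or.inl h₁⟩
  · exact ⟨v, by grind, hcard, Or.inl h₂⟩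
  · exact ⟨u, by grind, hcard, Or.inr h₁⟩
  · exact absurd rfl hab

/-- When the third node of a bad triangle on `a`, `b` becomes the pivot, it takes `a` or `b`; so
this cannot happen again for a node processed later. -/
lemma not_allActiveAt_of_lt {adj : Fin N → Fin N → Bool} {c ε : ℝ} {π : Equiv.Perm (Fin N)}
    {a b w w' : Fin N} (hw : adj w a = true ∨ adj w b = true) (hlt : π w < π w')
    (h : allActiveAt adj c ε {a, b, w} w π) : ¬ allActiveAt adj c ε {a, b, w'} w' π := by
  intro h'
  have hact := h w (by simp)
  have ha := (midState_active_of_lt hlt (h' a (by simp))).2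
  have hb := (midState_active_of_lt hlt (h' b (by simp))).2
  rw [Equiv.symm_apply_apply] at ha hb
  exact hw.elim (fun h => ha ⟨hact, Or.inr h⟩) fun h => hb ⟨hact, Or.inr h⟩

/-- For every unordered pair `e = {a,b}` of distinct vertices,
`Σ_{t ∈ T, e ⊆ t} p_t ≤ 3`; equivalently, `y_t = p_t/3` is a feasible fractional
bad-triangle packing. -/
theorem sum_pt_over_pair_le_three (N : ℕ) (c ε : ℝ) (hc : 0 < c) (hε0 : 0 < ε) (hε1 : ε < 1)
    (adj : Fin N → Fin N → Bool)
    (hsymm : ∀ u v, adj u v = adj v u) (hirr : ∀ u, adj u u = false)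
    (a b : Fin N) (hab : a ≠ b) :
    ∑ t ∈ (badTriangles adj).filter (fun t => a ∈ t ∧ b ∈ t),
      Pr N (eventA adj c ε t) ≤ 3 := by
  set S := (badTriangles adj).filter (fun t => a ∈ t ∧ b ∈ t) with hS
  have hthird : ∀ t ∈ S, ∃ w, t = {a, b, w} ∧ t.card = 3 ∧
      (adj w a = true ∨ adj w b = true) := by
    intro t ht
    simp only [hS, badTriangles, Finset.mem_filter, Finset.mem_univ, true_and] at ht
    exact ht.1.exists_third hsymm hab ht.2.1 ht.2.2
  have : Nonempty (Fin N) := ⟨a⟩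
  choose! w hw hcard hadj using hthird
  have hdisj : (S : Set (Finset (Fin N))).PairwiseDisjoint
      fun t => Finset.univ.filter (allActiveAt adj c ε t (w t)) := by
    intro t ht t' ht' hne
    refine Finset.disjoint_left.mpr fun π hπ hπ' => ?_
    have hww : w t ≠ w t' := fun he => hne (by rw [hw t ht, hw t' ht', he])
    have h : allActiveAt adj c ε {a, b, w t} (w t) π := by
      rw [← hw t ht]
      exact (Finset.mem_filter.mp hπ).2
    have h' : allActiveAt adj c ε {a, b, w t'} (w t') π := by
      rw [← hw t' ht']
      exact (Finset.mem_filter.mp hπ').2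
    rcases lt_or_gt_of_ne (π.injective.ne hww) with hlt | hlt
    · exact not_allActiveAt_of_lt (hadj t ht) hlt h h'
    · exact not_allActiveAt_of_lt (hadj t' ht') hlt h' h
  have hsum : ∑ t ∈ S, (Finset.univ.filter (eventA adj c ε t)).card ≤ 3 * Nat.factorial N :=
    calc ∑ t ∈ S, (Finset.univ.filter (eventA adj c ε t)).card
        ≤ ∑ t ∈ S, 3 * (Finset.univ.filter (allActiveAt adj c ε t (w t))).card := by
          refine Finset.sum_le_sum fun t ht => ?_
          have hmem : w t ∈ t := by
            have : w t ∈ ({a, b, w t} : Finset (Fin N)) := by simp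
            rwa [← hw t ht] at this
          simpa only [hcard t ht] using card_eventA_le adj c ε hmem
      _ = 3 * (S.biUnion fun t => Finset.univ.filter (allActiveAt adj c ε t (w t))).card := by
          rw [← Finset.mul_sum, Finset.card_biUnion hdisj]
      _ ≤ 3 * Nat.factorial N := by
          refine Nat.mul_le_mul_left 3 ((Finset.card_le_univ _).trans_eq ?_)
          rw [Fintype.card_perm, Fintype.card_fin]
  simp only [Pr]
  rw [← Finset.sum_div, div_le_iff₀ (by exact_mod_cast Nat.factorial_pos N)]
  exact_mod_cast hsum


end TruncatedPivot
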